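/- Let T be the Gauss map with repeller Λ = [0,1]∖ℚ and for α > 2 let ψ_α := (α/2 − 1)ψ where ψ := log|T'|. Then for all α > 2, the Hausdorff dimension of D_0(ψ_α) equals 2/α. -/

import Mathlib

open Set Filter Topology

/-- The Gauss map `x ↦ 1/x - ⌊1/x⌋` (with `T 0 = 0`). -/
noncomputable def gaussMap : ℝ → ℝ := fun x => if x = 0 then 0 else Int.fract x⁻¹

/-- The repeller of the Gauss map: `Λ = [0,1] \ ℚ`. -/
def gaussRepeller : Set ℝ := {x ∈ Set.Icc (0:ℝ) 1 | Irrational x}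

/-- `ψ = log |T'|` for the Gauss map. -/
noncomputable def gaussPsi : ℝ → ℝ := fun x => Real.log |deriv gaussMap x|

/-- Birkhoff sum `S_n(f)(x) = ∑_{l<n} f(T^l x)` for the Gauss map. -/
noncomputable def gaussBirkhoff (f : ℝ → ℝ) (n : ℕ) (x : ℝ) : ℝ :=
  ∑ l ∈ Finset.range n, f (gaussMap^[l] x)

/-- The shrinking target set `D_y(φ)` for the Gauss map. -/
def gaussTarget (y : ℝ) (φ : ℝ → ℝ) : Set ℝ :=
  ⋂ m : ℕ, ⋃ n : ℕ, ⋃ _ : m ≤ n,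
    {x | x ∈ gaussRepeller ∧ |gaussMap^[n] x - y| < Real.exp (-(gaussBirkhoff φ n x))}

/-! ### Dynamics of the Gauss map and convergents -/

lemma gaussMap_eq_fract (x : ℝ) : gaussMap x = Int.fract x⁻¹ := by
  by_cases h : x = 0 <;> simp [gaussMap, h]

lemma mem_gaussRepeller_iff {x : ℝ} : x ∈ gaussRepeller ↔ x ∈ Ioo (0 : ℝ) 1 ∧ Irrational x := by
  constructor
  · rintro ⟨⟨h0, h1⟩, hx⟩
    exact ⟨⟨lt_of_le_of_ne h0 (fun h => hx.ne_zero h.symm), lt_of_le_of_ne h1 hx.ne_one⟩, hx⟩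
  · rintro ⟨⟨h0, h1⟩, hx⟩
    exact ⟨⟨h0.le, h1.le⟩, hx⟩

lemma gaussMap_mem_gaussRepeller {x : ℝ} (hx : x ∈ gaussRepeller) :
    gaussMap x ∈ gaussRepeller := by
  rw [gaussMap_eq_fract]
  exact ⟨⟨Int.fract_nonneg _, (Int.fract_lt_one _).le⟩, hx.2.inv.sub_intCast _⟩

lemma gaussMap_iterate_mem_gaussRepeller {x : ℝ} (hx : x ∈ gaussRepeller) (n : ℕ) :
    gaussMap^[n] x ∈ gaussRepeller := by
  induction n with
  | zero => exact hx
  | succ n ih =>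
    rw [Function.iterate_succ_apply']
    exact gaussMap_mem_gaussRepeller ih

lemma hasDerivAt_gaussMap {x : ℝ} (hx : x ∈ gaussRepeller) :
    HasDerivAt gaussMap (-(x ^ 2)⁻¹) x := by
  obtain ⟨⟨h0, h1⟩, hirr⟩ := mem_gaussRepeller_iff.1 hx
  have hd : HasDerivAt (fun y : ℝ => y⁻¹ - (⌊x⁻¹⌋ : ℝ)) (-(x ^ 2)⁻¹) x :=
    (hasDerivAt_inv h0.ne').sub_const _
  refine hd.congr_of_eventuallyEq ?_
  have hlt : (⌊x⁻¹⌋ : ℝ) < x⁻¹ :=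
    lt_of_le_of_ne (Int.floor_le _) (hirr.inv.ne_int _).symm
  have hc : ContinuousAt (fun y : ℝ => y⁻¹) x := continuousAt_inv₀ h0.ne'
  filter_upwards [hc.eventually (Ioo_mem_nhds hlt (Int.lt_floor_add_one _))] with y hy
  have : ⌊y⁻¹⌋ = ⌊x⁻¹⌋ := Int.floor_eq_iff.2 ⟨hy.1.le, hy.2⟩
  rw [gaussMap_eq_fract, Int.fract, this]

lemma gaussPsi_eq {x : ℝ} (hx : x ∈ gaussRepeller) : gaussPsi x = -2 * Real.log x := by
  rw [gaussPsi, (hasDerivAt_gaussMap hx).deriv, Real.log_abs, Real.log_neg_eq_log, Real.log_inv,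
    Real.log_pow]
  push_cast
  ring

/-- The product of the first `n` points of the orbit of `x` under the Gauss map. -/
noncomputable def gaussOrbitProd (n : ℕ) (x : ℝ) : ℝ := ∏ l ∈ Finset.range n, gaussMap^[l] x

lemma gaussOrbitProd_zero (x : ℝ) : gaussOrbitProd 0 x = 1 := by simp [gaussOrbitProd]

lemma gaussOrbitProd_succ (n : ℕ) (x : ℝ) :
    gaussOrbitProd (n + 1) x = x * gaussOrbitProd n (gaussMap x) := by
  simp [gaussOrbitProd, Finset.prod_range_succ', mul_comm]

lemma gaussOrbitProd_pos {x : ℝ} (hx : x ∈ gaussRepeller) (n : ℕ) : 0 < gaussOrbitProd n x :=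
  Finset.prod_pos fun l _ =>
    (mem_gaussRepeller_iff.1 (gaussMap_iterate_mem_gaussRepeller hx l)).1.1

lemma exp_neg_gaussBirkhoff {x : ℝ} (hx : x ∈ gaussRepeller) (α : ℝ) (n : ℕ) :
    Real.exp (-(gaussBirkhoff (fun x => (α / 2 - 1) * gaussPsi x) n x)) =
      gaussOrbitProd n x ^ (α - 2) := by
  have hlog : Real.log (gaussOrbitProd n x) =
      ∑ l ∈ Finset.range n, Real.log (gaussMap^[l] x) :=
    Real.log_prod fun l _ =>
      (mem_gaussRepeller_iff.1 (gaussMap_iterate_mem_gaussRepeller hx l)).1.1.ne'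
  rw [Real.rpow_def_of_pos (gaussOrbitProd_pos hx n), hlog, gaussBirkhoff, Finset.sum_mul,
    ← Finset.sum_neg_distrib]
  congr 1
  refine Finset.sum_congr rfl fun l _ => ?_
  rw [gaussPsi_eq (gaussMap_iterate_mem_gaussRepeller hx l)]
  ring

lemma gaussOrbitProd_le {x : ℝ} (hx : x ∈ gaussRepeller) (n : ℕ) :
    gaussOrbitProd n x ≤ 2 * (1 / 2 : ℝ) ^ ((n : ℝ) / 2) := by
  induction n using Nat.twoStepInduction generalizing x with
  | zero => simp [gaussOrbitProd_zero]
  | one =>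
    rw [gaussOrbitProd_succ, gaussOrbitProd_zero, mul_one]
    have h1 := (mem_gaussRepeller_iff.1 hx).1.2
    have : (1 / 2 : ℝ) ^ (1 : ℝ) ≤ (1 / 2 : ℝ) ^ (((1 : ℕ) : ℝ) / 2) :=
      Real.rpow_le_rpow_of_exponent_ge (by norm_num) (by norm_num) (by norm_num)
    rw [Real.rpow_one] at this
    linarith
  | more n ih _ =>
    rw [gaussOrbitProd_succ, gaussOrbitProd_succ, ← mul_assoc]
    have hx' := gaussMap_mem_gaussRepeller hx
    have h := ih (gaussMap_mem_gaussRepeller hx')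
    obtain ⟨⟨h0, h1⟩, -⟩ := mem_gaussRepeller_iff.1 hx
    have hprod : x * gaussMap x ≤ 1 / 2 := by
      have hT : gaussMap x = x⁻¹ - (⌊x⁻¹⌋ : ℝ) := by rw [gaussMap_eq_fract, Int.fract]
      have h1a : (1 : ℝ) ≤ (⌊x⁻¹⌋ : ℝ) := by
        exact_mod_cast Int.le_floor.2 (by simpa using (one_le_inv₀ h0).2 h1.le)
      have hlt := (mem_gaussRepeller_iff.1 hx').1.2
      have hxx : x * x⁻¹ = 1 := mul_inv_cancel₀ h0.ne'
      have : x * gaussMap x = 1 - x * ⌊x⁻¹⌋ := by rw [hT, mul_sub, hxx]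
      nlinarith
    have hexp : (1 / 2 : ℝ) ^ (((n + 2 : ℕ) : ℝ) / 2) =
        (1 / 2 : ℝ) ^ ((n : ℝ) / 2) * (1 / 2) := by
      rw [show (((n + 2 : ℕ) : ℝ) / 2) = (n : ℝ) / 2 + 1 by push_cast; ring,
        Real.rpow_add (by norm_num), Real.rpow_one]
    rw [hexp]
    have := gaussOrbitProd_pos (gaussMap_mem_gaussRepeller hx') n
    nlinarith

lemma convergent_intCast_add (a : ℤ) (y : ℝ) (n : ℕ) :
    Real.convergent (a + y) n = a + Real.convergent y n := by
  cases n with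
  | zero => simp
  | succ n => simp [add_assoc]

/-- The matrix form of the `n`-th convergent of `x`, in terms of the Gauss orbit of `x`. -/
lemma exists_convergent_matrix {x : ℝ} (hx : x ∈ gaussRepeller) (n : ℕ) :
    ∃ p q p' q' : ℤ, 0 ≤ p ∧ 0 < q ∧ 0 ≤ p' ∧ 0 ≤ q' ∧ q' ≤ q ∧ q' + p' ≤ q + p ∧
      |q * p' - p * q'| = 1 ∧
      x * (q + q' * gaussMap^[n] x) = p + p' * gaussMap^[n] x ∧
      (q + q' * gaussMap^[n] x) * gaussOrbitProd n x = 1 ∧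
      Real.convergent x n = (p : ℚ) / q := by
  induction n generalizing x with
  | zero =>
    obtain ⟨⟨h0, h1⟩, -⟩ := mem_gaussRepeller_iff.1 hx
    have : ⌊x⌋ = 0 := Int.floor_eq_zero_iff.2 ⟨h0.le, h1⟩
    exact ⟨0, 1, 1, 0, by simp [this, gaussOrbitProd_zero]⟩
  | succ n ih =>
    obtain ⟨⟨h0, h1⟩, -⟩ := mem_gaussRepeller_iff.1 hx
    obtain ⟨p, q, p', q', hp, hq, hp', hq', hle, hle', hdet, hxe, hD, hc⟩ :=
      ih (gaussMap_mem_gaussRepeller hx)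
    set a : ℤ := ⌊x⁻¹⌋ with ha
    have ha1 : 1 ≤ a := Int.le_floor.2 (by simpa using (one_le_inv₀ h0).2 h1.le)
    have hinv : x⁻¹ = a + gaussMap x := by
      rw [gaussMap_eq_fract, Int.floor_add_fract]
    have hxa : x * (a + gaussMap x) = 1 := by rw [← hinv, mul_inv_cancel₀ h0.ne']
    have hfl : ⌊x⌋ = 0 := Int.floor_eq_zero_iff.2 ⟨h0.le, h1⟩
    have hfr : Int.fract x = x := Int.fract_eq_self.2 ⟨h0.le, h1⟩
    refine ⟨q, a * q + p, q', a * q' + p', hq.le, by positivity, hq', by positivity, ?_, ?_, ?_,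
      ?_, ?_, ?_⟩
    · nlinarith
    · nlinarith
    · rw [← hdet, ← abs_neg]
      congr 1
      ring
    · rw [Function.iterate_succ_apply]
      push_cast
      linear_combination (q + q' * gaussMap^[n] (gaussMap x)) * hxa - x * hxe
    · rw [Function.iterate_succ_apply, gaussOrbitProd_succ]
      push_cast
      linear_combination (-x * gaussOrbitProd n (gaussMap x)) * hxe +
        x * (a + gaussMap x) * hD + hxa
    · rw [Real.convergent_succ, hfl, hfr, hinv, convergent_intCast_add, hc]
      have : (q : ℚ) ≠ 0 := by exact_mod_cast hq.ne'
      push_cast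
      field_simp
      simp

lemma convergent_den_bounds {x : ℝ} (hx : x ∈ gaussRepeller) (n : ℕ) :
    ((Real.convergent x n).den : ℝ) * gaussOrbitProd n x ≤ 1 ∧
      1 ≤ 2 * (((Real.convergent x n).den : ℝ) * gaussOrbitProd n x) ∧
      (Real.convergent x n).den * |x - Real.convergent x n| =
        gaussMap^[n] x * gaussOrbitProd n x := by
  obtain ⟨p, q, p', q', hp, hq, hp', hq', hle, hle', hdet, hxe, hD, hc⟩ :=
    exists_convergent_matrix hx n
  have hDpos := gaussOrbitProd_pos hx n
  obtain ⟨⟨hθ0, hθ1⟩, -⟩ := mem_gaussRepeller_iff.1 (gaussMap_iterate_mem_gaussRepeller hx n)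
  set θ := gaussMap^[n] x
  set D := gaussOrbitProd n x
  have hcop : IsCoprime p q := by
    rcases (abs_eq (zero_le_one' ℤ)).1 hdet with h | h
    · exact ⟨-q', p', by linear_combination h⟩
    · exact ⟨q', -p', by linear_combination -h⟩
  have hden : ((Real.convergent x n).den : ℤ) = q := by
    rw [hc]
    exact Rat.den_div_eq_of_coprime hq (Int.isCoprime_iff_nat_coprime.1 hcop)
  have hdenR : ((Real.convergent x n).den : ℝ) = q := by exact_mod_cast hden
  have hqR : (0 : ℝ) < q := by exact_mod_cast hq
  have hq'R : (0 : ℝ) ≤ q' := by exact_mod_cast hq'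
  have hleR : (q' : ℝ) ≤ q := by exact_mod_cast hle
  rw [hdenR]
  have hq'θ : q' * θ ≤ q := by nlinarith
  refine ⟨?_, ?_, ?_⟩
  · nlinarith [mul_nonneg hq'R hθ0.le]
  · nlinarith
  · have h0 : (q : ℝ) * |x - Real.convergent x n| = |q * (x - Real.convergent x n)| := by
      rw [abs_mul, abs_of_pos hqR]
    rw [h0, hc]
    push_cast
    have h1 : (q : ℝ) * (x - p / q) = q * x - p := by field_simp
    rw [h1]
    have h2 : (q : ℝ) * x - p = (q * p' - p * q') * θ * D := by
      linear_combination (-(q * x - p : ℝ)) * hD + q * D * hxe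
    have h3 : |(q * p' - p * q' : ℝ)| = 1 := by exact_mod_cast hdet
    rw [h2, abs_mul, abs_mul, h3, abs_of_pos hθ0, abs_of_pos hDpos, one_mul]

lemma mem_gaussTarget_zero_iff {α x : ℝ} :
    x ∈ gaussTarget 0 (fun x => (α / 2 - 1) * gaussPsi x) ↔
      x ∈ gaussRepeller ∧ ∀ m : ℕ, ∃ n, m ≤ n ∧ gaussMap^[n] x < gaussOrbitProd n x ^ (α - 2) := by
  simp only [gaussTarget, mem_iInter, mem_iUnion, mem_ofPred_eq, exists_prop, sub_zero]
  constructor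
  · intro h
    have hx : x ∈ gaussRepeller := by
      obtain ⟨n, -, hx, -⟩ := h 0
      exact hx
    refine ⟨hx, fun m => ?_⟩
    obtain ⟨n, hn, -, hlt⟩ := h m
    rw [exp_neg_gaussBirkhoff hx] at hlt
    exact ⟨n, hn, (le_abs_self _).trans_lt hlt⟩
  · rintro ⟨hx, h⟩ m
    obtain ⟨n, hn, hlt⟩ := h m
    refine ⟨n, hn, hx, ?_⟩
    rwa [exp_neg_gaussBirkhoff hx,
      abs_of_pos (mem_gaussRepeller_iff.1 (gaussMap_iterate_mem_gaussRepeller hx n)).1.1]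

lemma abs_sub_convergent_lt {α x : ℝ} (hα : 2 < α) (hx : x ∈ gaussRepeller) {n : ℕ}
    (h : gaussMap^[n] x < gaussOrbitProd n x ^ (α - 2)) :
    |x - Real.convergent x n| < ((Real.convergent x n).den : ℝ) ^ (-α) := by
  obtain ⟨h1, -, h3⟩ := convergent_den_bounds hx n
  have hD := gaussOrbitProd_pos hx n
  have hq : (0 : ℝ) < (Real.convergent x n).den := by exact_mod_cast (Real.convergent x n).pos
  set q : ℝ := ((Real.convergent x n).den : ℝ)
  set D := gaussOrbitProd n x
  have hDq : D ≤ q⁻¹ := by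
    rw [← one_div, le_div_iff₀ hq]
    linarith
  have key : q * |x - Real.convergent x n| < q * q ^ (-α) := by
    calc q * |x - Real.convergent x n| = gaussMap^[n] x * D := h3
      _ < D ^ (α - 2) * D := mul_lt_mul_of_pos_right h hD
      _ = D ^ (α - 1) := by
        rw [← Real.rpow_add_one hD.ne']
        congr 1
        ring
      _ ≤ q⁻¹ ^ (α - 1) := Real.rpow_le_rpow hD.le hDq (by linarith)
      _ = q * q ^ (-α) := by
        rw [Real.inv_rpow hq.le, ← Real.rpow_neg hq.le, mul_comm, ← Real.rpow_add_one hq.ne']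
        congr 1
        ring
  exact lt_of_mul_lt_mul_left key hq.le

lemma gaussMap_iterate_lt_of_abs_sub_convergent {α x : ℝ} (hα : 2 < α)
    (hx : x ∈ gaussRepeller) {n : ℕ}
    (h : |x - Real.convergent x n| ≤ 2 ^ (-α) * ((Real.convergent x n).den : ℝ) ^ (-α)) :
    gaussMap^[n] x < gaussOrbitProd n x ^ (α - 2) := by
  obtain ⟨-, h2, h3⟩ := convergent_den_bounds hx n
  have hD := gaussOrbitProd_pos hx n
  have hq : (0 : ℝ) < (Real.convergent x n).den := by exact_mod_cast (Real.convergent x n).pos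
  set q : ℝ := ((Real.convergent x n).den : ℝ)
  set D := gaussOrbitProd n x
  have hDq : (2 * q)⁻¹ ≤ D := by
    rw [inv_le_iff_one_le_mul₀ (by positivity)]
    linarith
  have h2q : (0 : ℝ) < 2 * q := by positivity
  have key : gaussMap^[n] x * D < D ^ (α - 2) * D := by
    calc gaussMap^[n] x * D = q * |x - Real.convergent x n| := h3.symm
      _ ≤ q * (2 ^ (-α) * q ^ (-α)) := mul_le_mul_of_nonneg_left h hq.le
      _ < (2 * q) * (2 ^ (-α) * q ^ (-α)) := by
        have : (0 : ℝ) < 2 ^ (-α) * q ^ (-α) := by positivity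
        nlinarith
      _ = (2 * q)⁻¹ ^ (α - 1) := by
        rw [← Real.mul_rpow (by norm_num) hq.le, Real.inv_rpow h2q.le, ← Real.rpow_neg h2q.le,
          mul_comm, ← Real.rpow_add_one h2q.ne']
        congr 1
        ring
      _ ≤ D ^ (α - 1) := Real.rpow_le_rpow (by positivity) hDq (by linarith)
      _ = D ^ (α - 2) * D := by
        rw [← Real.rpow_add_one hD.ne']
        congr 1
        ring
  exact lt_of_mul_lt_mul_right key hD.le

lemma two_rpow_mul_rpow_lt {α q : ℝ} (hα : 2 < α) (hq : 1 ≤ q) :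
    2 ^ (-α) * q ^ (-α) < 1 / (2 * q ^ 2) := by
  have h1 : (2 : ℝ) ^ (-α) < 2⁻¹ := by
    calc (2 : ℝ) ^ (-α) < 2 ^ (-1 : ℝ) :=
          Real.rpow_lt_rpow_of_exponent_lt (by norm_num) (by linarith)
      _ = 2⁻¹ := Real.rpow_neg_one 2
  have h2 : q ^ (-α) ≤ (q ^ 2)⁻¹ := by
    calc q ^ (-α) ≤ q ^ (-2 : ℝ) := Real.rpow_le_rpow_of_exponent_le hq (by linarith)
      _ = (q ^ 2)⁻¹ := by
        rw [Real.rpow_neg (by positivity)]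
        norm_num
  rw [one_div, mul_inv]
  exact mul_lt_mul h1 h2 (by positivity) (by norm_num)

lemma mem_gaussTarget_of_approx {α x : ℝ} (hα : 2 < α) (hx : x ∈ gaussRepeller)
    (h : ∀ ε : ℝ, 0 < ε → ∃ r : ℚ, |x - r| < ε ∧ |x - r| ≤ 2 ^ (-α) * (r.den : ℝ) ^ (-α)) :
    x ∈ gaussTarget 0 (fun x => (α / 2 - 1) * gaussPsi x) := by
  rw [mem_gaussTarget_zero_iff]
  refine ⟨hx, fun m => ?_⟩
  have hε : ∃ ε : ℝ, 0 < ε ∧ ∀ n < m, ε ≤ |x - Real.convergent x n| := by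
    have hpos : ∀ n, 0 < |x - Real.convergent x n| := fun n =>
      abs_pos.2 (sub_ne_zero.2 (hx.2.ne_rat _))
    rcases Nat.eq_zero_or_pos m with rfl | hm
    · exact ⟨1, one_pos, by simp⟩
    · obtain ⟨k, -, hk⟩ := Finset.exists_min_image (Finset.range m)
        (fun n => |x - Real.convergent x n|) ⟨0, Finset.mem_range.2 hm⟩
      exact ⟨_, hpos k, fun n hn => hk n (Finset.mem_range.2 hn)⟩
  obtain ⟨ε, hε, hmin⟩ := hε
  obtain ⟨r, hr, hr'⟩ := h ε hε
  have hq1 : (1 : ℝ) ≤ r.den := by exact_mod_cast r.pos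
  have hlt : |x - r| < 1 / (2 * (r.den : ℝ) ^ 2) :=
    hr'.trans_lt (two_rpow_mul_rpow_lt hα hq1)
  obtain ⟨n, rfl⟩ := Real.exists_rat_eq_convergent hlt
  refine ⟨n, ?_, gaussMap_iterate_lt_of_abs_sub_convergent hα hx hr'⟩
  by_contra! hn
  exact (hmin n hn).not_gt hr

/-! ### The upper bound -/

lemma exists_rat_of_mem_gaussTarget {α x : ℝ} (hα : 2 < α)
    (hx : x ∈ gaussTarget 0 (fun x => (α / 2 - 1) * gaussPsi x)) (K : ℕ) :
    ∃ p q : ℕ, K ≤ q ∧ p ≤ q ∧ |x - p / q| ≤ (q : ℝ) ^ (-α) := by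
  obtain ⟨hx, h⟩ := mem_gaussTarget_zero_iff.1 hx
  have hlim : Tendsto (fun n : ℕ => 2 * (1 / 2 : ℝ) ^ ((n : ℝ) / 2)) atTop (𝓝 0) := by
    have h1 : Tendsto (fun n : ℕ => (n : ℝ) / 2) atTop atTop :=
      tendsto_natCast_atTop_atTop.atTop_div_const (by norm_num)
    simpa using ((tendsto_rpow_atTop_of_base_lt_one (1 / 2 : ℝ) (by norm_num)
      (by norm_num)).comp h1).const_mul 2
  have hK : (0 : ℝ) < 1 / (2 * (K + 1)) := by positivity
  obtain ⟨m, hm⟩ := (hlim.eventually (gt_mem_nhds hK)).exists_forall_of_atTop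
  obtain ⟨n, hn, hlt⟩ := h m
  have happ := abs_sub_convergent_lt hα hx hlt
  obtain ⟨h1, h2, h3⟩ := convergent_den_bounds hx n
  have hDK : gaussOrbitProd n x < 1 / (2 * (K + 1)) := (gaussOrbitProd_le hx n).trans_lt (hm n hn)
  have hD := gaussOrbitProd_pos hx n
  obtain ⟨⟨hθ0, hθ1⟩, -⟩ := mem_gaussRepeller_iff.1 (gaussMap_iterate_mem_gaussRepeller hx n)
  obtain ⟨⟨hx0, hx1⟩, -⟩ := mem_gaussRepeller_iff.1 hx
  set r := Real.convergent x n
  have hq : (1 : ℝ) ≤ r.den := by exact_mod_cast r.pos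
  have hnum : (r : ℝ) = (r.num : ℝ) / r.den := Rat.cast_def r
  have hclose : |r.den * x - r.num| < 1 := by
    have : (r.den : ℝ) * x - r.num = r.den * (x - r) := by
      rw [hnum]
      field_simp
    rw [this, abs_mul, abs_of_pos (by linarith), h3]
    nlinarith
  obtain ⟨hc1, hc2⟩ := abs_lt.1 hclose
  have hn0 : 0 ≤ r.num := by
    have : (-1 : ℝ) < r.num := by nlinarith
    have : (-1 : ℤ) < r.num := by exact_mod_cast this
    omega
  have hn1 : r.num ≤ r.den := by
    have : (r.num : ℝ) < r.den + 1 := by nlinarith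
    have : r.num < r.den + 1 := by exact_mod_cast this
    omega
  refine ⟨r.num.toNat, r.den, ?_, by omega, ?_⟩
  · rw [lt_div_iff₀ (by positivity)] at hDK
    have : (K : ℝ) + 1 < r.den := by nlinarith
    have : K + 1 < r.den := by exact_mod_cast this
    omega
  · have : ((r.num.toNat : ℕ) : ℝ) = r.num := by exact_mod_cast Int.toNat_of_nonneg hn0
    rw [this, ← hnum]
    exact happ.le

lemma dimH_gaussTarget_zero_le {α : ℝ} (hα : 2 < α) (s : NNReal) (hs : 2 / α < s) :
    dimH (gaussTarget 0 (fun x => (α / 2 - 1) * gaussPsi x)) ≤ s := by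
  have hα0 : 0 < α := by linarith
  have hs0 : (0 : ℝ) < s := lt_trans (by positivity) hs
  have hexp : 1 - α * s < -1 := by
    rw [div_lt_iff₀ hα0] at hs
    linarith
  refine dimH_le_of_hausdorffMeasure_ne_top (ne_of_lt ?_)
  set F : ℕ → ENNReal := fun j => ENNReal.ofReal (2 * 2 ^ (s : ℝ) * ((j : ℝ) + 1) ^ (1 - α * s))
    with hF
  have hFsum : ∑' j, F j ≠ ⊤ := by
    refine Summable.tsum_ofReal_ne_top ?_
    refine Summable.mul_left _ ?_
    have := (summable_nat_add_iff 1).2 (Real.summable_nat_rpow.2 hexp)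
    simpa using this
  have hlim := ENNReal.tendsto_sum_nat_add F hFsum
  let t : ∀ K : ℕ, (Σ j : ℕ, Fin (j + K + 2)) → Set ℝ := fun K i =>
    Icc ((i.2 : ℕ) / ((i.1 + K + 1 : ℕ) : ℝ) - ((i.1 + K + 1 : ℕ) : ℝ) ^ (-α))
      ((i.2 : ℕ) / ((i.1 + K + 1 : ℕ) : ℝ) + ((i.1 + K + 1 : ℕ) : ℝ) ^ (-α))
  have hdiam : ∀ K i, Metric.ediam (t K i) =
      ENNReal.ofReal (2 * ((i.1 + K + 1 : ℕ) : ℝ) ^ (-α)) := by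
    intro K i
    rw [Real.ediam_Icc]
    congr 1
    ring
  have hr : Tendsto (fun K : ℕ => ENNReal.ofReal (2 * ((K : ℝ) + 1) ^ (-α))) atTop (𝓝 0) := by
    rw [← ENNReal.ofReal_zero]
    refine ENNReal.tendsto_ofReal ?_
    have h1 : Tendsto (fun K : ℕ => (K : ℝ) + 1) atTop atTop :=
      tendsto_atTop_add_const_right _ _ tendsto_natCast_atTop_atTop
    simpa using ((tendsto_rpow_neg_atTop hα0).comp h1).const_mul 2
  have hle := MeasureTheory.Measure.hausdorffMeasure_le_liminf_tsum (s : ℝ)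
    (gaussTarget 0 (fun x => (α / 2 - 1) * gaussPsi x)) (l := atTop) _ hr t
    (Eventually.of_forall fun K i => ?_) (Eventually.of_forall fun K x hx => ?_)
  · refine lt_of_le_of_lt (hle.trans (liminf_le_liminf (v := fun K => ∑' j, F (j + K))
      (Eventually.of_forall fun K => ?_))) ?_
    · rw [ENNReal.tsum_sigma']
      refine ENNReal.tsum_le_tsum fun j => ?_
      simp only [hdiam]
      rw [tsum_fintype, Finset.sum_const, Finset.card_univ, Fintype.card_fin, nsmul_eq_mul,
        ENNReal.ofReal_rpow_of_nonneg (by positivity) hs0.le, hF,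
        ← ENNReal.ofReal_natCast, ← ENNReal.ofReal_mul (by positivity)]
      refine ENNReal.ofReal_le_ofReal ?_
      have hq : (1 : ℝ) ≤ ((j + K + 1 : ℕ) : ℝ) := by exact_mod_cast Nat.le_add_left 1 _
      have hq' : ((j + K : ℕ) : ℝ) + 1 = ((j + K + 1 : ℕ) : ℝ) := by push_cast; ring
      have hq'' : ((j + K + 2 : ℕ) : ℝ) ≤ 2 * ((j + K + 1 : ℕ) : ℝ) := by
        push_cast at hq ⊢
        linarith
      rw [hq']
      set q : ℝ := ((j + K + 1 : ℕ) : ℝ)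
      have hq0 : 0 < q := by linarith
      calc ((j + K + 2 : ℕ) : ℝ) * (2 * q ^ (-α)) ^ (s : ℝ)
          ≤ (2 * q) * (2 * q ^ (-α)) ^ (s : ℝ) :=
            mul_le_mul_of_nonneg_right hq'' (by positivity)
        _ = 2 * 2 ^ (s : ℝ) * q ^ (1 - α * s) := by
          rw [Real.mul_rpow (by norm_num) (by positivity), ← Real.rpow_mul hq0.le,
            sub_eq_add_neg, Real.rpow_add hq0, Real.rpow_one, neg_mul]
          ring
    · rw [hlim.liminf_eq]
      exact ENNReal.zero_lt_top
  · rw [hdiam]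
    refine ENNReal.ofReal_le_ofReal (mul_le_mul_of_nonneg_left ?_ (by norm_num))
    refine Real.rpow_le_rpow_of_nonpos (by positivity) ?_ (by linarith)
    push_cast
    linarith [(Nat.cast_nonneg i.1 : (0 : ℝ) ≤ i.1)]
  · obtain ⟨p, q, hKq, hpq, hxq⟩ := exists_rat_of_mem_gaussTarget hα hx (K + 1)
    obtain ⟨j, rfl⟩ : ∃ j, q = j + K + 1 := ⟨q - (K + 1), by omega⟩
    rw [abs_le] at hxq
    exact mem_iUnion.2 ⟨⟨j, ⟨p, by omega⟩⟩, by dsimp only [t]; linarith, by dsimp only [t]; linarith⟩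

/-! ### Counting rationals of bounded denominator in an interval -/

lemma finite_rat_Icc_den_le (a b : ℝ) (Q : ℕ) :
    {r : ℚ | a ≤ r ∧ (r : ℝ) ≤ b ∧ r.den ≤ Q}.Finite := by
  refine ((Finset.finite_toSet ((Finset.Icc 1 Q).biUnion fun q =>
    (Finset.Icc ⌈a * q⌉ ⌊b * q⌋).image fun p : ℤ => (p : ℚ) / (q : ℚ)))).subset ?_
  rintro r ⟨ha, hb, hQ⟩
  have hq : (0 : ℝ) < r.den := by exact_mod_cast r.pos
  have hr : (r : ℝ) * r.den = r.num := by exact_mod_cast Rat.mul_den_eq_num r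
  simp only [Finset.coe_biUnion, mem_iUnion, Finset.coe_image, mem_image]
  refine ⟨r.den, Finset.mem_coe.2 (Finset.mem_Icc.2 ⟨r.pos, hQ⟩), r.num,
    Finset.mem_coe.2 (Finset.mem_Icc.2 ⟨Int.ceil_le.2 ?_, Int.le_floor.2 ?_⟩), Rat.num_div_den r⟩
  · rw [← hr]
    exact mul_le_mul_of_nonneg_right ha hq.le
  · rw [← hr]
    exact mul_le_mul_of_nonneg_right hb hq.le

lemma card_Icc_ceil_floor_le {u v : ℝ} (h : u ≤ v) :
    ((Finset.Icc ⌈u⌉ ⌊v⌋).card : ℝ) ≤ v - u + 1 := by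
  rw [Int.card_Icc]
  have h1 : (((⌊v⌋ + 1 - ⌈u⌉).toNat : ℤ) : ℝ) = ((max (⌊v⌋ + 1 - ⌈u⌉) 0 : ℤ) : ℝ) := by
    rw [Int.toNat_eq_max]
  rw [Int.cast_natCast] at h1
  rw [h1]
  push_cast
  refine max_le ?_ (by linarith)
  linarith [Int.floor_le v, Int.le_ceil u]

lemma eventually_rat_count {L : ℝ} (hL : 0 < L) :
    ∀ᶠ Q : ℕ in atTop, ∀ a : ℝ, ∃ G : Finset ℚ,
      (∀ r ∈ G, a ≤ r ∧ (r : ℝ) ≤ a + L ∧ r.den ≤ Q) ∧ L * (Q : ℝ) ^ 2 / 128 ≤ G.card := by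
  have hlog : Tendsto (fun Q : ℕ => (1 + Real.log Q) / (Q : ℝ)) atTop (𝓝 0) := by
    have h1 : Tendsto (fun x : ℝ => (1 + Real.log x) / x) atTop (𝓝 0) := by
      have h2 := (tendsto_inv_atTop_zero (𝕜 := ℝ)).add
        (Real.isLittleO_log_id_atTop.tendsto_div_nhds_zero)
      simp only [add_zero] at h2
      refine h2.congr fun x => ?_
      simp only [id]
      ring
    exact h1.comp tendsto_natCast_atTop_atTop
  have hinv : Tendsto (fun Q : ℕ => (1 : ℝ) / (Q : ℝ)) atTop (𝓝 0) :=
    tendsto_one_div_atTop_nhds_zero_nat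
  filter_upwards [hlog.eventually (gt_mem_nhds (show (0 : ℝ) < L / 16 by positivity)),
    hinv.eventually (gt_mem_nhds (show (0 : ℝ) < L / 4 by positivity)),
    eventually_ge_atTop 1] with Q hQlog hQinv hQ1 a
  have hQ : (1 : ℝ) ≤ Q := by exact_mod_cast hQ1
  have hfin := finite_rat_Icc_den_le a (a + L) Q
  refine ⟨hfin.toFinset, fun r hr => hfin.mem_toFinset.1 hr, ?_⟩
  set G := hfin.toFinset with hG
  set m : ℕ := Q / 16 with hm
  have hcover : Icc (a + L / 4) (a + 3 * L / 4) ⊆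
      (⋃ q ∈ Finset.Icc 1 m, ⋃ p ∈ Finset.Icc ⌈a * (q : ℕ)⌉ ⌊(a + L) * (q : ℕ)⌋,
        Metric.closedBall ((p : ℝ) / (q : ℕ)) (1 / (q * Q))) ∪
      ⋃ r ∈ G, Metric.closedBall (r : ℝ) (16 / (Q : ℝ) ^ 2) := by
    rintro x ⟨hx1, hx2⟩
    obtain ⟨r, hr, hrQ⟩ := Real.exists_rat_abs_sub_le_and_den_le x hQ1
    have hq1 : (1 : ℝ) ≤ r.den := by exact_mod_cast r.pos
    have hr1 : |x - r| ≤ 1 / (r.den * Q) := by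
      refine hr.trans (one_div_le_one_div_of_le (by positivity) ?_)
      nlinarith
    have hr2 : |x - r| ≤ L / 4 := by
      refine hr1.trans (le_trans ?_ hQinv.le)
      exact one_div_le_one_div_of_le (by positivity) (by nlinarith)
    obtain ⟨hr3, hr4⟩ := abs_le.1 hr2
    have hra : a ≤ r := by linarith
    have hrb : (r : ℝ) ≤ a + L := by linarith
    have hrn : (r : ℝ) * r.den = r.num := by exact_mod_cast Rat.mul_den_eq_num r
    by_cases hqm : r.den ≤ m
    · left
      simp only [mem_iUnion]
      refine ⟨r.den, Finset.mem_Icc.2 ⟨r.pos, hqm⟩, r.num,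
        Finset.mem_Icc.2 ⟨Int.ceil_le.2 ?_, Int.le_floor.2 ?_⟩, ?_⟩
      · rw [← hrn]
        exact mul_le_mul_of_nonneg_right hra (by linarith)
      · rw [← hrn]
        exact mul_le_mul_of_nonneg_right hrb (by linarith)
      · rw [Metric.mem_closedBall, Real.dist_eq, ← Rat.cast_def]
        exact hr1
    · right
      simp only [mem_iUnion]
      refine ⟨r, hfin.mem_toFinset.2 ⟨hra, hrb, hrQ⟩, ?_⟩
      rw [Metric.mem_closedBall, Real.dist_eq]
      refine hr1.trans ?_
      have h16 : Q < 16 * r.den := by omega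
      have h16' : (Q : ℝ) < 16 * r.den := by exact_mod_cast h16
      rw [div_le_div_iff₀ (by positivity) (by positivity)]
      nlinarith
  have hsmall : ∀ q ∈ Finset.Icc 1 m,
      MeasureTheory.volume (⋃ p ∈ Finset.Icc ⌈a * (q : ℕ)⌉ ⌊(a + L) * (q : ℕ)⌋,
        Metric.closedBall ((p : ℝ) / (q : ℕ)) (1 / ((q : ℝ) * Q))) ≤
      ENNReal.ofReal (2 * L / Q + 2 / Q * (q : ℝ)⁻¹) := by
    intro q hq
    have hq1 : (1 : ℝ) ≤ q := by exact_mod_cast (Finset.mem_Icc.1 hq).1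
    refine (MeasureTheory.measure_biUnion_finset_le _ _).trans ?_
    simp only [Real.volume_closedBall, Finset.sum_const, nsmul_eq_mul]
    rw [← ENNReal.ofReal_natCast, ← ENNReal.ofReal_mul (by positivity)]
    refine ENNReal.ofReal_le_ofReal ?_
    have hc := card_Icc_ceil_floor_le (show a * (q : ℝ) ≤ (a + L) * q by nlinarith)
    calc _ ≤ ((a + L) * q - a * q + 1) * (2 * (1 / ((q : ℝ) * Q))) :=
          mul_le_mul_of_nonneg_right hc (by positivity)
      _ = _ := by
        field_simp
        ring
  have hvol : ENNReal.ofReal (L / 2) ≤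
      ENNReal.ofReal (∑ q ∈ Finset.Icc 1 m, (2 * L / Q + 2 / Q * (q : ℝ)⁻¹)) +
        ENNReal.ofReal (G.card * (32 / (Q : ℝ) ^ 2)) := by
    calc ENNReal.ofReal (L / 2) = MeasureTheory.volume (Icc (a + L / 4) (a + 3 * L / 4)) := by
          rw [Real.volume_Icc]
          congr 1
          ring
      _ ≤ _ := MeasureTheory.measure_mono hcover
      _ ≤ _ := MeasureTheory.measure_union_le _ _
      _ ≤ _ := by
        refine add_le_add ?_ ?_
        · refine (MeasureTheory.measure_biUnion_finset_le _ _).trans ?_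
          rw [ENNReal.ofReal_sum_of_nonneg fun q _ => by positivity]
          exact Finset.sum_le_sum hsmall
        · refine (MeasureTheory.measure_biUnion_finset_le _ _).trans ?_
          simp only [Real.volume_closedBall, Finset.sum_const, nsmul_eq_mul]
          rw [← ENNReal.ofReal_natCast, ← ENNReal.ofReal_mul (by positivity)]
          refine ENNReal.ofReal_le_ofReal (le_of_eq ?_)
          ring
  rw [← ENNReal.ofReal_add (Finset.sum_nonneg fun q _ => by positivity) (by positivity),
    ENNReal.ofReal_le_ofReal_iff
      (add_nonneg (Finset.sum_nonneg fun q _ => by positivity) (by positivity))] at hvol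
  have hharm : ∑ q ∈ Finset.Icc 1 m, (q : ℝ)⁻¹ ≤ 1 + Real.log Q := by
    have h1 := harmonic_le_one_add_log m
    rw [harmonic_eq_sum_Icc] at h1
    push_cast at h1
    refine h1.trans ?_
    rcases Nat.eq_zero_or_pos m with h0 | h0
    · rw [h0]
      simpa using Real.log_nonneg hQ
    · have : (m : ℝ) ≤ Q := by exact_mod_cast Nat.div_le_self Q 16
      linarith [Real.log_le_log (by exact_mod_cast h0) this]
  rw [Finset.sum_add_distrib, ← Finset.mul_sum, Finset.sum_const, Nat.card_Icc, nsmul_eq_mul,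
    Nat.add_sub_cancel] at hvol
  have hm16 : (m : ℝ) * 16 ≤ Q := by exact_mod_cast Nat.div_mul_le_self Q 16
  have hA : (m : ℝ) * (2 * L / Q) ≤ L / 8 := by
    rw [← mul_div_assoc, div_le_iff₀ (by positivity)]
    nlinarith
  have hB : 2 / (Q : ℝ) * ∑ q ∈ Finset.Icc 1 m, (q : ℝ)⁻¹ ≤ L / 8 := by
    calc 2 / (Q : ℝ) * ∑ q ∈ Finset.Icc 1 m, (q : ℝ)⁻¹ ≤ 2 / (Q : ℝ) * (1 + Real.log Q) :=
          mul_le_mul_of_nonneg_left hharm (by positivity)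
      _ = 2 * ((1 + Real.log Q) / Q) := by ring
      _ ≤ L / 8 := by linarith
  have hfinal : L / 4 ≤ G.card * (32 / (Q : ℝ) ^ 2) := by linarith
  rw [← mul_div_assoc, le_div_iff₀ (by positivity)] at hfinal
  linarith

lemma one_div_sq_le_sub_of_den_le {r r' : ℚ} {Q : ℕ} (h : r < r') (hr : r.den ≤ Q)
    (hr' : r'.den ≤ Q) : 1 / (Q : ℝ) ^ 2 ≤ (r' : ℝ) - r := by
  have hq : (0 : ℝ) < r.den := by exact_mod_cast r.pos
  have hq' : (0 : ℝ) < r'.den := by exact_mod_cast r'.pos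
  have hrQ : (r.den : ℝ) ≤ Q := by exact_mod_cast hr
  have hrQ' : (r'.den : ℝ) ≤ Q := by exact_mod_cast hr'
  have hn : (r : ℝ) * r.den = r.num := by exact_mod_cast Rat.mul_den_eq_num r
  have hn' : (r' : ℝ) * r'.den = r'.num := by exact_mod_cast Rat.mul_den_eq_num r'
  have hlt : (r : ℝ) < r' := by exact_mod_cast h
  have key : ((r' : ℝ) - r) * (r.den * r'.den) =
      ((r'.num * r.den - r.num * r'.den : ℤ) : ℝ) := by
    push_cast
    rw [← hn, ← hn']
    ring
  have hpos : (0 : ℝ) < ((r'.num * r.den - r.num * r'.den : ℤ) : ℝ) := by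
    rw [← key]
    exact mul_pos (by linarith) (by positivity)
  have hone : (1 : ℝ) ≤ ((r'.num * r.den - r.num * r'.den : ℤ) : ℝ) := by
    have : (0 : ℤ) < r'.num * r.den - r.num * r'.den := by exact_mod_cast hpos
    exact_mod_cast this
  rw [div_le_iff₀ (by nlinarith)]
  calc (1 : ℝ) ≤ ((r' : ℝ) - r) * (r.den * r'.den) := by rw [key]; exact hone
    _ ≤ ((r' : ℝ) - r) * (Q : ℝ) ^ 2 := by
      refine mul_le_mul_of_nonneg_left ?_ (by linarith)
      nlinarith

lemma exists_separated_enumeration {G : Finset ℚ} {N Q : ℕ} (hN : N ≤ G.card)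
    (hG : ∀ r ∈ G, r.den ≤ Q) :
    ∃ f : ℕ → ℚ, (∀ i < N, f i ∈ G) ∧
      ∀ i j, i < j → j < N → ((j : ℝ) - i) / (Q : ℝ) ^ 2 ≤ (f j : ℝ) - f i := by
  let e := G.orderEmbOfCardLe hN
  let f : ℕ → ℚ := fun i => if h : i < N then e ⟨i, h⟩ else 0
  have hf : ∀ i (h : i < N), f i = e ⟨i, h⟩ := fun i h => dif_pos h
  have hmem : ∀ i < N, f i ∈ G := fun i h => by
    rw [hf i h]
    exact G.orderEmbOfCardLe_mem hN _
  refine ⟨f, hmem, fun i j hij hj => ?_⟩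
  induction j, hij using Nat.le_induction with
  | base =>
    have hlt : f i < f (i + 1) := by
      rw [hf i (by omega), hf (i + 1) hj]
      exact e.strictMono (Fin.mk_lt_mk.2 (Nat.lt_succ_self i))
    simpa using one_div_sq_le_sub_of_den_le hlt (hG _ (hmem i (by omega))) (hG _ (hmem _ hj))
  | succ j hij ih =>
    have hlt : f j < f (j + 1) := by
      rw [hf j (by omega), hf (j + 1) hj]
      exact e.strictMono (Fin.mk_lt_mk.2 (Nat.lt_succ_self j))
    have h1 := one_div_sq_le_sub_of_den_le hlt (hG _ (hmem j (by omega))) (hG _ (hmem _ hj))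
    have h2 := ih (by omega)
    have h3 : (((j + 1 : ℕ) : ℝ) - i) / (Q : ℝ) ^ 2 =
        ((j : ℝ) - i) / (Q : ℝ) ^ 2 + 1 / (Q : ℝ) ^ 2 := by
      push_cast
      ring
    linarith

/-! ### The lower bound -/

/-- One level of a Cantor set built from rational points: the intervals are
`[pt m, pt m + len]` for `m < card`, and `one_le` says that the mass `1 / card` of each of them is
at most `len ^ s`. -/
structure CantorLevel (s : ℝ) where
  len : ℝ
  card : ℕ
  pt : ℕ → ℚ
  len_pos : 0 < len
  card_pos : 0 < card
  one_le : 1 ≤ card * len ^ s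

/-- `B` refines `A` if every interval of `A` contains exactly `N` intervals of `B`, whose left
endpoints have denominator at most `Q` and are `1 / Q ^ 2`-separated. -/
structure CantorLevel.Refines {s : ℝ} (α : ℝ) (A B : CantorLevel s) (Q N : ℕ) : Prop where
  two_le : 2 ≤ N
  one_le_den : 1 ≤ Q
  card_eq : B.card = A.card * N
  len_le : B.len ≤ A.len / 2
  len_eq : B.len = 2 ^ (-α) * (Q : ℝ) ^ (-α)
  len_le_count : A.len * (Q : ℝ) ^ 2 ≤ 512 * N
  le_pt : ∀ m, (A.pt (m / N) : ℝ) ≤ B.pt m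
  pt_le : ∀ m, (B.pt m : ℝ) ≤ A.pt (m / N) + A.len / 2
  den_le : ∀ m, (B.pt m).den ≤ Q
  sub_le : ∀ m m' : ℕ, m < m' → m / N = m' / N →
    ((m' : ℝ) - m) / (Q : ℝ) ^ 2 ≤ (B.pt m' : ℝ) - B.pt m

lemma CantorLevel.exists_refines {s α : ℝ} (hα : 2 < α) (hs : α * s < 2) (A : CantorLevel s) :
    ∃ (B : CantorLevel s) (Q N : ℕ), A.Refines α B Q N := by
  have hL := A.len_pos
  have hαs : 0 < 2 - α * s := by linarith
  have hnat := tendsto_natCast_atTop_atTop (R := ℝ)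
  have h1 : Tendsto (fun Q : ℕ => A.len / 512 * (2 ^ (-α)) ^ s * (Q : ℝ) ^ (2 - α * s))
      atTop atTop :=
    ((tendsto_rpow_atTop hαs).comp hnat).const_mul_atTop (by positivity)
  have h2 : Tendsto (fun Q : ℕ => A.len / 512 * (Q : ℝ) ^ 2) atTop atTop :=
    ((tendsto_pow_atTop two_ne_zero).comp hnat).const_mul_atTop (by positivity)
  have h3 : Tendsto (fun Q : ℕ => 2 ^ (-α) * (Q : ℝ) ^ (-α)) atTop (𝓝 0) := by
    simpa using ((tendsto_rpow_neg_atTop (by linarith : (0 : ℝ) < α)).comp hnat).const_mul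
      ((2 : ℝ) ^ (-α))
  obtain ⟨Q, hQ1, hQ2, hQ3, hQ4, hQ5⟩ := ((h1.eventually_ge_atTop 1).and
    ((h2.eventually_ge_atTop 1).and ((h3.eventually (ge_mem_nhds (half_pos hL))).and
      ((eventually_ge_atTop 1).and (eventually_rat_count (half_pos hL)))))).exists
  have hQ : (1 : ℝ) ≤ Q := by exact_mod_cast hQ4
  set N : ℕ := ⌊A.len / 2 * (Q : ℝ) ^ 2 / 128⌋₊ with hN
  have hNle : (N : ℝ) ≤ A.len / 2 * (Q : ℝ) ^ 2 / 128 := Nat.floor_le (by positivity)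
  have hN2 : 2 ≤ N := by
    refine Nat.le_floor ?_
    push_cast
    linarith
  have hNge : A.len * (Q : ℝ) ^ 2 ≤ 512 * N := by
    have := Nat.lt_floor_add_one (A.len / 2 * (Q : ℝ) ^ 2 / 128)
    rw [← hN] at this
    linarith
  choose G hG hGcard using hQ5
  have hcard : ∀ a, N ≤ (G a).card := fun a => by exact_mod_cast hNle.trans (hGcard a)
  choose f hf hfsep using fun a : ℝ =>
    exists_separated_enumeration (hcard a) fun r hr => (hG a r hr).2.2
  have hmod : ∀ m, m % N < N := fun m => Nat.mod_lt _ (by omega)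
  have hmem := fun m : ℕ => hG _ _ (hf (A.pt (m / N)) _ (hmod m))
  refine ⟨⟨2 ^ (-α) * (Q : ℝ) ^ (-α), A.card * N, fun m => f (A.pt (m / N)) (m % N),
    by positivity, Nat.mul_pos A.card_pos (by omega), ?_⟩, Q, N, hN2, hQ4, rfl, hQ3, rfl, hNge,
    fun m => (hmem m).1, fun m => (hmem m).2.1, fun m => (hmem m).2.2, fun m m' hlt heq => ?_⟩
  · have hc : (1 : ℝ) ≤ A.card := by exact_mod_cast A.card_pos
    have hQ0 : (0 : ℝ) < Q := by linarith
    have hsplit : (Q : ℝ) ^ (2 - α * s) = (Q : ℝ) ^ 2 * ((Q : ℝ) ^ (-α)) ^ s := by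
      rw [← Real.rpow_mul hQ0.le, ← Real.rpow_natCast (Q : ℝ) 2, ← Real.rpow_add hQ0]
      congr 1
      push_cast
      ring
    rw [hsplit] at hQ1
    rw [Real.mul_rpow (by positivity) (by positivity)]
    push_cast
    calc (1 : ℝ) ≤ A.len / 512 * (2 ^ (-α)) ^ s * ((Q : ℝ) ^ 2 * ((Q : ℝ) ^ (-α)) ^ s) := hQ1
      _ = (A.len * (Q : ℝ) ^ 2 / 512) * ((2 ^ (-α)) ^ s * ((Q : ℝ) ^ (-α)) ^ s) := by ring
      _ ≤ (A.card * N) * ((2 ^ (-α)) ^ s * ((Q : ℝ) ^ (-α)) ^ s) := by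
        refine mul_le_mul_of_nonneg_right ?_ (by positivity)
        have : (N : ℝ) ≤ A.card * N := le_mul_of_one_le_left (by positivity) hc
        linarith
  · have hm := Nat.div_add_mod m N
    have hm' := Nat.div_add_mod m' N
    rw [← heq] at hm'
    have hltmod : m % N < m' % N := by omega
    have hcast : (m' : ℝ) - m = ((m' % N : ℕ) : ℝ) - ((m % N : ℕ) : ℝ) := by
      have h5 : m' + m % N = m' % N + m := by omega
      have h6 : (m' : ℝ) + ((m % N : ℕ) : ℝ) = ((m' % N : ℕ) : ℝ) + m := by exact_mod_cast h5
      linarith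
    dsimp only
    rw [← heq, hcast]
    exact hfsep _ _ _ hltmod (hmod m')

section Limit

variable {s α : ℝ} {A : ℕ → CantorLevel s} {Q N : ℕ → ℕ}

/-- The index of the interval of the `k`-th level assigned to the parameter `t`. -/
noncomputable def cantorIndex (A : ℕ → CantorLevel s) (t : ℝ) (k : ℕ) : ℕ :=
  ⌊t * (A k).card⌋₊

/-- The point of the Cantor set assigned to the parameter `t`. -/
noncomputable def cantorPoint (A : ℕ → CantorLevel s) (t : ℝ) : ℝ :=
  ⨆ k, ((A k).pt (cantorIndex A t k) : ℝ)

lemma cantorIndex_succ_div (hA : ∀ k, (A k).Refines α (A (k + 1)) (Q k) (N k)) (t : ℝ) (k : ℕ) :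
    cantorIndex A t (k + 1) / N k = cantorIndex A t k := by
  have hN : (N k : ℝ) ≠ 0 := by
    have := (hA k).two_le
    exact_mod_cast (by omega : N k ≠ 0)
  rw [cantorIndex, cantorIndex, ← Nat.floor_div_natCast, (hA k).card_eq]
  congr 1
  push_cast
  field_simp

lemma pt_cantorIndex_le_cantorPoint_and_le
    (hA : ∀ k, (A k).Refines α (A (k + 1)) (Q k) (N k)) (t : ℝ) (k : ℕ) :
    ((A k).pt (cantorIndex A t k) : ℝ) ≤ cantorPoint A t ∧
      cantorPoint A t ≤ (A k).pt (cantorIndex A t k) + (A k).len := by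
  have hmono : Monotone fun k => ((A k).pt (cantorIndex A t k) : ℝ) :=
    monotone_nat_of_le_succ fun k => by
      simpa only [cantorIndex_succ_div hA] using (hA k).le_pt (cantorIndex A t (k + 1))
  have hanti : Antitone fun k => ((A k).pt (cantorIndex A t k) : ℝ) + (A k).len :=
    antitone_nat_of_succ_le fun k => by
      have h1 := (hA k).pt_le (cantorIndex A t (k + 1))
      rw [cantorIndex_succ_div hA] at h1
      linarith [(hA k).len_le]
  have hle : ∀ j k, ((A j).pt (cantorIndex A t j) : ℝ) ≤
      (A k).pt (cantorIndex A t k) + (A k).len := fun j k => by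
    have h1 := hmono (le_max_left j k)
    have h2 := hanti (le_max_right j k)
    have h3 := (A (max j k)).len_pos
    dsimp only at h1 h2
    linarith
  exact ⟨le_ciSup (f := fun k => ((A k).pt (cantorIndex A t k) : ℝ))
    ⟨_, forall_mem_range.2 fun j => hle j 0⟩ k, ciSup_le fun j => hle j k⟩

lemma two_pow_le_card (hA : ∀ k, (A k).Refines α (A (k + 1)) (Q k) (N k)) (k : ℕ) :
    2 ^ k ≤ (A k).card := by
  induction k with
  | zero => exact (A 0).card_pos
  | succ k ih =>
    rw [(hA k).card_eq, pow_succ]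
    exact Nat.mul_le_mul ih (hA k).two_le

lemma len_le_half_pow (hA : ∀ k, (A k).Refines α (A (k + 1)) (Q k) (N k)) (k : ℕ) :
    (A k).len ≤ (A 0).len * (1 / 2) ^ k := by
  induction k with
  | zero => simp
  | succ k ih =>
    have := (hA k).len_le
    rw [pow_succ]
    linarith

lemma exists_cantorIndex_branch (hA : ∀ k, (A k).Refines α (A (k + 1)) (Q k) (N k))
    (h0 : (A 0).card = 1) {t t' : ℝ} (ht : t ∈ Ico (0 : ℝ) 1) (ht' : t' ∈ Ico (0 : ℝ) 1)
    (hlt : t < t') :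
    ∃ k, cantorIndex A t k = cantorIndex A t' k ∧
      cantorIndex A t (k + 1) < cantorIndex A t' (k + 1) := by
  have hzero : cantorIndex A t 0 = cantorIndex A t' 0 := by
    simp [cantorIndex, h0, Nat.floor_eq_zero.2 ht.2, Nat.floor_eq_zero.2 ht'.2]
  by_contra! hcon
  have hmono : ∀ k, cantorIndex A t k ≤ cantorIndex A t' k := fun k =>
    Nat.floor_le_floor (mul_le_mul_of_nonneg_right hlt.le (Nat.cast_nonneg _))
  have heq : ∀ k, cantorIndex A t k = cantorIndex A t' k := fun k => by
    induction k with
    | zero => exact hzero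
    | succ k ih => exact le_antisymm (hmono _) (hcon k ih)
  obtain ⟨k, hk⟩ := pow_unbounded_of_one_lt (1 / (t' - t)) (one_lt_two (α := ℝ))
  have hcard : (2 : ℝ) ^ k ≤ (A k).card := by exact_mod_cast two_pow_le_card hA k
  rw [div_lt_iff₀ (by linarith)] at hk
  have h1 : t' * (A k).card < cantorIndex A t' k + 1 := Nat.lt_floor_add_one _
  have h2 : (cantorIndex A t k : ℝ) ≤ t * (A k).card :=
    Nat.floor_le (mul_nonneg ht.1 (Nat.cast_nonneg _))
  rw [heq k] at h2
  nlinarith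

lemma sub_le_cantorPoint_sub_rpow (hA : ∀ k, (A k).Refines α (A (k + 1)) (Q k) (N k))
    (hα : 2 < α) (hs0 : 0 < s) (hs1 : s ≤ 1) (h0 : (A 0).card = 1) {t t' : ℝ}
    (ht : t ∈ Ico (0 : ℝ) 1) (ht' : t' ∈ Ico (0 : ℝ) 1) (hlt : t < t') :
    cantorPoint A t < cantorPoint A t' ∧
      t' - t ≤ 2 * 1024 ^ s * (cantorPoint A t' - cantorPoint A t) ^ s := by
  obtain ⟨k, hk, hk'⟩ := exists_cantorIndex_branch hA h0 ht ht' hlt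
  have hR := hA k
  have hdiv := cantorIndex_succ_div hA t k
  have hdiv' := cantorIndex_succ_div hA t' k
  have hx := (pt_cantorIndex_le_cantorPoint_and_le hA t (k + 1)).2
  have hx' := (pt_cantorIndex_le_cantorPoint_and_le hA t' (k + 1)).1
  have hsep := hR.sub_le _ _ hk' (by rw [hdiv, hdiv', hk])
  have hQ : (1 : ℝ) ≤ Q k := by exact_mod_cast hR.one_le_den
  have hlen : (A (k + 1)).len < 1 / (2 * (Q k : ℝ) ^ 2) := by
    rw [hR.len_eq]
    exact two_rpow_mul_rpow_lt hα hQ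
  have hN2 := hR.two_le
  have hN : (0 : ℝ) < N k := by exact_mod_cast (by omega : 0 < N k)
  have hjN : cantorIndex A t' (k + 1) - cantorIndex A t (k + 1) ≤ N k := by
    have h1 := Nat.div_add_mod (cantorIndex A t (k + 1)) (N k)
    have h2 := Nat.div_add_mod (cantorIndex A t' (k + 1)) (N k)
    have h3 := Nat.mod_lt (cantorIndex A t' (k + 1)) (by omega : N k > 0)
    rw [hdiv] at h1
    rw [hdiv', ← hk] at h2
    omega
  obtain ⟨j, hj⟩ : ∃ j, cantorIndex A t' (k + 1) = cantorIndex A t (k + 1) + j :=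
    ⟨_, (Nat.add_sub_cancel' hk'.le).symm⟩
  have hj1 : (1 : ℝ) ≤ j := by exact_mod_cast (by omega : 1 ≤ j)
  have hjN' : (j : ℝ) ≤ N k := by exact_mod_cast (by omega : j ≤ N k)
  have hP : (0 : ℝ) < (A k).card := by exact_mod_cast (A k).card_pos
  have hcard : ((A (k + 1)).card : ℝ) = (A k).card * N k := by exact_mod_cast hR.card_eq
  have hPN : (0 : ℝ) < (A k).card * N k := mul_pos hP hN
  have hgap : (j : ℝ) / (2 * (Q k : ℝ) ^ 2) ≤ cantorPoint A t' - cantorPoint A t := by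
    rw [hj] at hsep hx'
    push_cast at hsep
    have h1 : (j : ℝ) / (Q k : ℝ) ^ 2 - 1 / (2 * (Q k : ℝ) ^ 2) ≥ j / (2 * (Q k : ℝ) ^ 2) := by
      rw [ge_iff_le, div_sub_div _ _ (by positivity) (by positivity),
        div_le_div_iff₀ (by positivity) (by positivity)]
      have : (0 : ℝ) < (Q k : ℝ) ^ 4 := by positivity
      nlinarith
    rw [add_sub_cancel_left] at hsep
    linarith
  refine ⟨sub_pos.1 (lt_of_lt_of_le (by positivity) hgap), ?_⟩
  have htt : t' - t ≤ 2 * ((j : ℝ) / N k) * (1 / (A k).card) := by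
    have h1 : t' * (A (k + 1)).card < cantorIndex A t' (k + 1) + 1 := Nat.lt_floor_add_one _
    have h2 : (cantorIndex A t (k + 1) : ℝ) ≤ t * (A (k + 1)).card :=
      Nat.floor_le (mul_nonneg ht.1 (Nat.cast_nonneg _))
    rw [hj] at h1
    push_cast at h1
    rw [hcard] at h1 h2
    have h3 : (t' - t) * ((A k).card * N k) ≤ 2 * j := by linarith
    have h4 : 2 * ((j : ℝ) / N k) * (1 / (A k).card) = 2 * j / ((A k).card * N k) := by
      field_simp
    rw [h4, le_div_iff₀ hPN]
    exact h3
  have hL := (A k).len_pos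
  have hmass : 1 / ((A k).card : ℝ) ≤ (A k).len ^ s := by
    rw [div_le_iff₀ hP, mul_comm]
    exact (A k).one_le
  have hfrac : (j : ℝ) / N k ≤ ((j : ℝ) / N k) ^ s := by
    have h1 : (j : ℝ) / N k ≤ 1 := (div_le_one hN).2 hjN'
    simpa using Real.rpow_le_rpow_of_exponent_ge (by positivity) h1 hs1
  calc t' - t ≤ 2 * ((j : ℝ) / N k) * (1 / (A k).card) := htt
    _ ≤ 2 * ((j : ℝ) / N k) ^ s * (A k).len ^ s := by gcongr
    _ = 2 * ((j : ℝ) / N k * (A k).len) ^ s := by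
      rw [Real.mul_rpow (by positivity) hL.le, mul_assoc]
    _ ≤ 2 * (1024 * (j / (2 * (Q k : ℝ) ^ 2))) ^ s := by
      refine mul_le_mul_of_nonneg_left (Real.rpow_le_rpow (by positivity) ?_ hs0.le) (by norm_num)
      have h1 := hR.len_le_count
      have h2 : 1024 * ((j : ℝ) / (2 * (Q k : ℝ) ^ 2)) = j * 512 / (Q k : ℝ) ^ 2 := by
        field_simp
        norm_num
      rw [h2, div_mul_eq_mul_div, div_le_div_iff₀ hN (by positivity)]
      nlinarith
    _ = 2 * 1024 ^ s * (j / (2 * (Q k : ℝ) ^ 2)) ^ s := by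
      rw [Real.mul_rpow (by norm_num) (by positivity), mul_assoc]
    _ ≤ 2 * 1024 ^ s * (cantorPoint A t' - cantorPoint A t) ^ s := by gcongr

end Limit

lemma le_dimH_image_of_dist_le {s C : NNReal} (hs : 0 < s) {f : ℝ → ℝ}
    (hf : ∀ t ∈ Ico (0 : ℝ) 1, ∀ t' ∈ Ico (0 : ℝ) 1, t < t' →
      f t < f t' ∧ t' - t ≤ C * (f t' - f t) ^ (s : ℝ)) :
    (s : ENNReal) ≤ dimH (f '' Ico 0 1) := by
  have hmono : StrictMonoOn f (Ico 0 1) := fun t ht t' ht' hlt => (hf t ht t' ht' hlt).1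
  set g := Function.invFunOn f (Ico 0 1)
  have hg : ∀ t ∈ Ico (0 : ℝ) 1, g (f t) = t := fun t ht =>
    hmono.injOn.leftInvOn_invFunOn ht
  have hdist : ∀ t ∈ Ico (0 : ℝ) 1, ∀ t' ∈ Ico (0 : ℝ) 1,
      dist t t' ≤ C * dist (f t) (f t') ^ (s : ℝ) := by
    intro t ht t' ht'
    rcases lt_trichotomy t t' with h | h | h
    · obtain ⟨h1, h2⟩ := hf t ht t' ht' h
      rwa [dist_comm, dist_comm (f t), Real.dist_eq, Real.dist_eq, abs_of_pos (sub_pos.2 h),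
        abs_of_pos (sub_pos.2 h1)]
    · rw [h, dist_self, dist_self]
      positivity
    · obtain ⟨h1, h2⟩ := hf t' ht' t ht h
      rwa [Real.dist_eq, Real.dist_eq, abs_of_pos (sub_pos.2 h), abs_of_pos (sub_pos.2 h1)]
  have hhol : HolderOnWith C s g (f '' Ico 0 1) := by
    rintro _ ⟨t, ht, rfl⟩ _ ⟨t', ht', rfl⟩
    rw [hg t ht, hg t' ht', edist_dist, edist_dist,
      ENNReal.ofReal_rpow_of_nonneg dist_nonneg s.coe_nonneg, ← ENNReal.ofReal_coe_nnreal,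
      ← ENNReal.ofReal_mul C.coe_nonneg]
    exact ENNReal.ofReal_le_ofReal (hdist t ht t' ht')
  have himage : g '' (f '' Ico 0 1) = Ico 0 1 := hmono.injOn.leftInvOn_invFunOn.image_image
  have hle := hhol.dimH_image_le hs
  have hone : dimH (Ico (0 : ℝ) 1) = 1 := by
    have := Real.dimH_of_nonempty_interior (s := Ico (0 : ℝ) 1) (by simp)
    simpa using this
  rw [himage, hone, ENNReal.le_div_iff_mul_le (Or.inl (by exact_mod_cast hs.ne'))
    (Or.inl ENNReal.coe_ne_top), one_mul] at hle
  exact hle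

lemma le_dimH_gaussTarget_zero {α : ℝ} (hα : 2 < α) (s : NNReal) (hs0 : 0 < s)
    (hs : (s : ℝ) < 2 / α) :
    (s : ENNReal) ≤ dimH (gaussTarget 0 (fun x => (α / 2 - 1) * gaussPsi x)) := by
  have hα0 : 0 < α := by linarith
  have hs1 : (s : ℝ) ≤ 1 := hs.le.trans ((div_le_one hα0).2 hα.le)
  rw [lt_div_iff₀ hα0, mul_comm] at hs
  choose next den num hnext using fun A : CantorLevel s => A.exists_refines hα hs
  let A₀ : CantorLevel s := ⟨1, 1, fun _ => 0, one_pos, one_pos, by simp⟩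
  let A : ℕ → CantorLevel s := fun k => next^[k] A₀
  have hA : ∀ k, (A k).Refines α (A (k + 1)) (den (A k)) (num (A k)) := fun k => by
    dsimp only [A]
    rw [Function.iterate_succ_apply']
    exact hnext _
  have hK : (s : ENNReal) ≤ dimH (cantorPoint A '' Ico 0 1) := by
    refine le_dimH_image_of_dist_le (C := 2 * 1024 ^ (s : ℝ)) hs0 fun t ht t' ht' hlt => ?_
    push_cast
    exact sub_le_cantorPoint_sub_rpow hA hα (by exact_mod_cast hs0) hs1 rfl ht ht' hlt
  have hsub : cantorPoint A '' Ico 0 1 ⊆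
      gaussTarget 0 (fun x => (α / 2 - 1) * gaussPsi x) ∪ range ((↑) : ℚ → ℝ) := by
    rintro _ ⟨t, -, rfl⟩
    by_cases hirr : Irrational (cantorPoint A t)
    · left
      have h0 := pt_cantorIndex_le_cantorPoint_and_le hA t 0
      have hmem : cantorPoint A t ∈ gaussRepeller :=
        ⟨⟨by simpa [A, A₀] using h0.1, by simpa [A, A₀] using h0.2⟩, hirr⟩
      refine mem_gaussTarget_of_approx hα hmem fun ε hε => ?_
      obtain ⟨k, hk⟩ := exists_pow_lt_of_lt_one hε (by norm_num : (1 / 2 : ℝ) < 1)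
      obtain ⟨h1, h2⟩ := pt_cantorIndex_le_cantorPoint_and_le hA t (k + 1)
      have hlen : (A (k + 1)).len ≤ (1 / 2) ^ k := by
        have h3 : (A (k + 1)).len ≤ 1 * (1 / 2) ^ (k + 1) := len_le_half_pow hA (k + 1)
        rw [pow_succ] at h3
        have : (0 : ℝ) < (1 / 2) ^ k := by positivity
        linarith
      refine ⟨(A (k + 1)).pt (cantorIndex A t (k + 1)), ?_, ?_⟩
      · rw [abs_of_nonneg (sub_nonneg.2 h1)]
        linarith
      · rw [abs_of_nonneg (sub_nonneg.2 h1)]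
        have hd := (hA k).den_le (cantorIndex A t (k + 1))
        refine (sub_le_iff_le_add'.2 h2).trans ?_
        rw [(hA k).len_eq]
        refine mul_le_mul_of_nonneg_left (Real.rpow_le_rpow_of_nonpos ?_ ?_ (by linarith))
          (by positivity)
        · exact_mod_cast Rat.pos _
        · exact_mod_cast hd
    · right
      exact not_not.1 hirr
  have := hK.trans (dimH_mono hsub)
  rwa [dimH_union, dimH_countable (countable_range _), max_eq_left zero_le] at this

/-- For all `α > 2`, `dim D_0(ψ_α) = 2/α` where `ψ_α = (α/2 - 1)ψ`. -/
theorem dimH_gaussTarget_zero_eq (α : ℝ) (hα : 2 < α) :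
    dimH (gaussTarget 0 (fun x => (α / 2 - 1) * gaussPsi x)) = ENNReal.ofReal (2 / α) := by
  have hpos : 0 < 2 / α := div_pos two_pos (by linarith)
  apply le_antisymm
  · refine ENNReal.le_of_forall_pos_le_add fun ε hε _ => ?_
    refine (dimH_gaussTarget_zero_le hα ((2 / α).toNNReal + ε) ?_).trans (le_of_eq ?_)
    · rw [NNReal.coe_add, Real.coe_toNNReal _ hpos.le]
      exact lt_add_of_pos_right _ (by exact_mod_cast hε)
    · rw [ENNReal.coe_add]
      rfl
  · refine le_of_forall_lt fun c hc => ?_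
    obtain ⟨s, hcs, hs⟩ := ENNReal.lt_iff_exists_nnreal_btwn.1 hc
    have hs' : (s : ℝ) < 2 / α := by
      rwa [← ENNReal.ofReal_coe_nnreal, ENNReal.ofReal_lt_ofReal_iff hpos] at hs
    exact hcs.trans_le
      (le_dimH_gaussTarget_zero hα s (by exact_mod_cast lt_of_le_of_lt zero_le hcs) hs')
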